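/- Let μ be a Radon measure on ℝ^N such that (supp μ, |·|_{ℝ^N}, μ) is a Lipschitz differentiability space. Assume moreover that for μ-a.e. x₀ ∈ supp μ the following nondegeneracy holds: the only vector ℓ ∈ ℝ^N satisfying lim_{x→x₀, x∈supp μ} |ℓ · (x − x₀)| / ‖x − x₀‖ = 0 is ℓ = 0. Then (supp μ, |·|_{ℝ^N}, μ) is a Lipschitz differentiability space with respect to the single N-dimensional chart (supp μ, id); that is, for every Lipschitz function f : supp μ → ℝ, for μ-a.e. x₀ ∈ supp μ there exists a unique df(x₀) ∈ ℝ^N with lim_{x→x₀, x∈supp μ} |f(x) − f(x₀) − df(x₀) · (x − x₀)| / ‖x − x₀‖ = 0. -/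

import Mathlib

open MeasureTheory Filter Set Metric Real
open scoped RealInnerProductSpace ENNReal Topology

noncomputable section

/-- A map is bi-Lipschitz onto its image on `E`: there is `L ≥ 1` with
`L⁻¹ d(x,y) ≤ d(F x, F y) ≤ L d(x,y)` for all `x, y ∈ E`. -/
def BiLipschitzOn {X Y : Type*} [MetricSpace X] [MetricSpace Y]
    (F : X → Y) (E : Set X) : Prop :=
  ∃ L : ℝ, 1 ≤ L ∧ ∀ x ∈ E, ∀ y ∈ E,
    L⁻¹ * dist x y ≤ dist (F x) (F y) ∧ dist (F x) (F y) ≤ L * dist x y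

/-- `f` is Lipschitz on the set `S` (with some constant). -/
def IsLipschitzOn {X Y : Type*} [MetricSpace X] [MetricSpace Y]
    (f : X → Y) (S : Set X) : Prop :=
  ∃ K : NNReal, LipschitzOnWith K f S

/-- `df` is the (Cheeger/Lipschitz) differential of `f` at `x` with respect to the chart map
`φ`, relative to the ambient set `S`:
`lim_{y → x, y ∈ S} |f y - f x - df ⬝ (φ y - φ x)| / d(y,x) = 0`. -/
def HasChartDerivAt {X : Type*} [MetricSpace X] (S : Set X) {n : ℕ}
    (φ : X → EuclideanSpace ℝ (Fin n)) (f : X → ℝ) (x : X)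
    (df : EuclideanSpace ℝ (Fin n)) : Prop :=
  Tendsto (fun y => |f y - f x - ⟪df, φ y - φ x⟫| / dist y x)
    (𝓝[S \ {x}] x) (𝓝 0)

/-- The data `(U i, φ i)` (with dimensions `n i`) is a Lipschitz-differentiability chart
structure for the metric measure space `(S, d, m)`. -/
structure LDSCharts {X : Type*} [MetricSpace X] [MeasurableSpace X]
    (m : Measure X) (S : Set X) (n : ℕ → ℕ) (U : ℕ → Set X)
    (φ : ∀ i, X → EuclideanSpace ℝ (Fin (n i))) : Prop where
  subset : ∀ i, U i ⊆ S
  borel : ∀ i, MeasurableSet (U i)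
  pos : ∀ i, 0 < m (U i)
  dimpos : ∀ i, 0 < n i
  cover : m (S \ ⋃ i, U i) = 0
  lip : ∀ i, IsLipschitzOn (φ i) (U i)
  diff : ∀ f : X → ℝ, IsLipschitzOn f S → ∀ i,
    ∀ᵐ x ∂(m.restrict (U i)), ∃! df, HasChartDerivAt S (φ i) f x df

/-- `(S, d, m)` is a Lipschitz differentiability space. -/
def IsLDS {X : Type*} [MetricSpace X] [MeasurableSpace X]
    (m : Measure X) (S : Set X) : Prop :=
  ∃ (n : ℕ → ℕ) (U : ℕ → Set X) (φ : ∀ i, X → EuclideanSpace ℝ (Fin (n i))),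
    LDSCharts m S n U φ

/-- `(X, d, m)` is locally bi-Lipschitz embeddable into Euclidean spaces. -/
def LocEuclEmbeddable {X : Type*} [MetricSpace X] [MeasurableSpace X]
    (m : Measure X) : Prop :=
  ∃ (N : ℕ → ℕ) (E : ℕ → Set X) (F : ∀ k, X → EuclideanSpace ℝ (Fin (N k))),
    (∀ k, MeasurableSet (E k)) ∧ m (Set.univ \ ⋃ k, E k) = 0 ∧
    ∀ k, BiLipschitzOn (F k) (E k)

/-- The closed cone of width `θ` around the linear subspace `V`:
the union of the cones `C(w, θ) = {v | v ⬝ w ≥ cos θ ‖v‖}` over unit vectors `w ∈ V`. -/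
def cone {N : ℕ} (V : Submodule ℝ (EuclideanSpace ℝ (Fin N))) (θ : ℝ) :
    Set (EuclideanSpace ℝ (Fin N)) :=
  {v | ∃ w ∈ V, ‖w‖ = 1 ∧ Real.cos θ * ‖v‖ ≤ ⟪w, v⟫}

/-- The (topological) support of a measure: the set of points all of whose open
neighbourhoods have positive measure. -/
def msupport {X : Type*} [TopologicalSpace X] [MeasurableSpace X]
    (μ : Measure X) : Set X :=
  {x | ∀ U : Set X, IsOpen U → x ∈ U → 0 < μ U}


lemma cutoff_exists {N : ℕ} {K V : Set (EuclideanSpace ℝ (Fin N))} (hK : IsCompact K)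
    (hV : IsOpen V) (hKV : K ⊆ V) :
    ∃ (χ : EuclideanSpace ℝ (Fin N) → ℝ) (M : ℝ), ContDiff ℝ 1 χ ∧ (∀ x, |χ x| ≤ 1) ∧
      (∀ x, ‖fderiv ℝ χ x‖ ≤ M) ∧ (∀ x ∈ K, χ x = 1) ∧ (∀ x, x ∉ V → χ =ᶠ[𝓝 x] 0) := by
  obtain ⟨R, hR⟩ := hK.isBounded.subset_ball (0 : EuclideanSpace ℝ (Fin N))
  have hcl : IsClosed (V ∩ ball 0 R)ᶜ := (hV.inter isOpen_ball).isClosed_compl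
  have hd : Disjoint (V ∩ ball 0 R)ᶜ K :=
    disjoint_compl_left_iff_subset.2 (subset_inter hKV hR)
  obtain ⟨f, h0, h1, h2⟩ := exists_contMDiffMap_zero_one_nhds_of_isClosed
    (modelWithCornersSelf ℝ (EuclideanSpace ℝ (Fin N))) (n := 1) hcl hK.isClosed hd
  have hf : ContDiff ℝ 1 f := f.contMDiff.contDiff
  have h0' : ∀ x ∉ V ∩ ball 0 R, (f : EuclideanSpace ℝ (Fin N) → ℝ) =ᶠ[𝓝 x] 0 := by
    intro x hx
    rw [eventually_nhdsSet_iff_forall] at h0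
    exact h0 x hx
  have hb : ∃ M, ∀ x ∈ closedBall (0 : EuclideanSpace ℝ (Fin N)) R, ‖fderiv ℝ f x‖ ≤ M :=
    (isCompact_closedBall _ _).exists_bound_of_continuousOn
      (hf.continuous_fderiv (by norm_num)).continuousOn
  obtain ⟨M, hM⟩ := hb
  refine ⟨f, max M 0, hf, fun x => ?_, fun x => ?_, fun x hx => ?_, fun x hx => ?_⟩
  · rw [abs_le]; constructor <;> linarith [(h2 x).1, (h2 x).2]
  · by_cases hx : x ∈ closedBall (0 : EuclideanSpace ℝ (Fin N)) R
    · exact (hM x hx).trans (le_max_left _ _)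
    · have : x ∉ V ∩ ball 0 R := fun h => hx (ball_subset_closedBall h.2)
      rw [(h0' x this).fderiv_eq]
      simp
  · exact h1.self_of_nhdsSet x hx
  · exact h0' x (fun h => hx h.1)

open scoped Convolution in
lemma smooth_approx {N : ℕ} {f : EuclideanSpace ℝ (Fin N) → ℝ} {L : NNReal}
    (hf : LipschitzWith L f) {ε : ℝ} (hε : 0 < ε) :
    ∃ F : EuclideanSpace ℝ (Fin N) → ℝ, ContDiff ℝ 1 F ∧ LipschitzWith L F ∧
      ∀ x, |F x - f x| ≤ ε := by
  set δ : ℝ := ε / (L + 1) with hδ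
  have hL : (0 : ℝ) ≤ L := L.2
  have hδ0 : 0 < δ := by positivity
  let φ : ContDiffBump (0 : EuclideanSpace ℝ (Fin N)) := ⟨δ / 2, δ, by positivity, by linarith⟩
  have hφs : HasCompactSupport (φ.normed volume) := φ.hasCompactSupport_normed
  have hφc : ContDiff ℝ 1 (φ.normed volume) := φ.contDiff_normed
  refine ⟨(φ.normed volume ⋆[ContinuousLinearMap.lsmul ℝ ℝ, volume] f : _ → ℝ), ?_, ?_, ?_⟩
  · exact hφs.contDiff_convolution_left _ hφc hf.continuous.locallyIntegrable
  · apply LipschitzWith.of_dist_le_mul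
    intro x y
    have hex : ∀ z, Integrable (fun t => φ.normed volume t * f (z - t)) volume := by
      intro z
      apply Continuous.integrable_of_hasCompactSupport
      · exact hφc.continuous.mul (hf.continuous.comp (continuous_const.sub continuous_id))
      · exact hφs.mul_right
    simp only [MeasureTheory.convolution, ContinuousLinearMap.lsmul_apply, smul_eq_mul]
    rw [Real.dist_eq, ← integral_sub (hex x) (hex y), ← Real.norm_eq_abs]
    calc _ ≤ ∫ t, φ.normed volume t * (L * dist x y) := by
          apply norm_integral_le_of_norm_le
          · exact (φ.integrable_normed).mul_const _
          · refine Eventually.of_forall fun t => ?_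
            rw [← mul_sub, norm_mul, Real.norm_eq_abs, Real.norm_eq_abs,
              abs_of_nonneg (φ.nonneg_normed t)]
            apply mul_le_mul_of_nonneg_left _ (φ.nonneg_normed t)
            have := hf.dist_le_mul (x - t) (y - t)
            rwa [Real.dist_eq, dist_sub_right] at this
      _ = L * dist x y := by
          rw [integral_mul_const, φ.integral_normed, one_mul]
  · intro x
    rw [← Real.dist_eq]
    apply φ.dist_normed_convolution_le hf.continuous.aestronglyMeasurable
    intro y hy
    refine (hf.dist_le_mul y x).trans ?_
    have h1 : dist y x ≤ δ := (mem_ball.1 hy).le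
    calc (L : ℝ) * dist y x ≤ (L + 1) * δ := by gcongr; linarith
      _ = ε := by rw [hδ]; field_simp

lemma dual_parallelogram {N : ℕ} (a b : EuclideanSpace ℝ (Fin N) →L[ℝ] ℝ) :
    ‖a - b‖ ^ 2 = 2 * ‖a‖ ^ 2 + 2 * ‖b‖ ^ 2 - 4 * ‖(1 / 2 : ℝ) • (a + b)‖ ^ 2 := by
  let T := (InnerProductSpace.toDual ℝ (EuclideanSpace ℝ (Fin N))).symm
  have h := parallelogram_law_with_norm ℝ (T a) (T b)
  rw [← map_add, ← map_sub] at h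
  simp only [LinearIsometryEquiv.norm_map] at h
  rw [norm_smul]
  norm_num
  nlinarith

/-- `C¹`, `L`-Lipschitz functions uniformly `ε`-close to `f`. -/
def ApproxClass {N : ℕ} (f : EuclideanSpace ℝ (Fin N) → ℝ) (L : NNReal) (ε : ℝ) :
    Set (EuclideanSpace ℝ (Fin N) → ℝ) :=
  {F | ContDiff ℝ 1 F ∧ LipschitzWith L F ∧ ∀ x, |F x - f x| ≤ ε}

lemma integrable_fderiv_sq {N : ℕ} (ν : Measure (EuclideanSpace ℝ (Fin N))) [IsFiniteMeasure ν]
    {F : EuclideanSpace ℝ (Fin N) → ℝ} {L : NNReal}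
    (hF : ContDiff ℝ 1 F) (hL : LipschitzWith L F) :
    Integrable (fun x => ‖fderiv ℝ F x‖ ^ 2) ν := by
  apply Integrable.of_bound (C := (L : ℝ) ^ 2)
  · refine Eventually.of_forall fun x => ?_
    rw [norm_pow, norm_norm]
    have := norm_fderiv_le_of_lipschitz ℝ hL (x₀ := x)
    gcongr
  · exact (((hF.continuous_fderiv (by norm_num)).norm).pow 2).aestronglyMeasurable

lemma energy_lemma {N : ℕ} (ν : Measure (EuclideanSpace ℝ (Fin N))) [IsFiniteMeasure ν]
    {f : EuclideanSpace ℝ (Fin N) → ℝ} {L : NNReal}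
    (hf : LipschitzWith L f) {η ε : ℝ} (hη : 0 < η) (hε : 0 < ε) :
    ∃ F ∈ ApproxClass f L ε, ∀ ε' > 0, ∃ F' ∈ ApproxClass f L ε',
      ∫ x, ‖fderiv ℝ F' x - fderiv ℝ F x‖ ^ 2 ∂ν ≤ η := by
  let Φ : (EuclideanSpace ℝ (Fin N) → ℝ) → ℝ := fun F => ∫ x, ‖fderiv ℝ F x‖ ^ 2 ∂ν
  let d : ℝ → ℝ := fun ε => sInf (Φ '' ApproxClass f L ε)
  have hΦ0 : ∀ F, 0 ≤ Φ F := fun F => integral_nonneg fun x => by positivity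
  have hbdd : ∀ ε, BddBelow (Φ '' ApproxClass f L ε) := fun ε =>
    ⟨0, by rintro _ ⟨F, _, rfl⟩; exact hΦ0 F⟩
  have hne : ∀ ε > 0, (Φ '' ApproxClass f L ε).Nonempty := fun ε hε =>
    Set.Nonempty.image Φ (smooth_approx hf hε)
  have hΦB : ∀ ε, ∀ F ∈ ApproxClass f L ε, Φ F ≤ (L : ℝ) ^ 2 * ν.real univ := by
    intro ε F hF
    calc Φ F ≤ ∫ x, (L : ℝ) ^ 2 ∂ν := by
          apply integral_mono (integrable_fderiv_sq ν hF.1 hF.2.1) (integrable_const _)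
          intro x
          have := norm_fderiv_le_of_lipschitz ℝ hF.2.1 (x₀ := x)
          simp only
          gcongr
      _ = _ := by simp [mul_comm]
  have hdB : BddAbove (d '' Ioi 0) := by
    refine ⟨(L : ℝ) ^ 2 * ν.real univ, ?_⟩
    rintro _ ⟨e, he, rfl⟩
    obtain ⟨_, F, hF, rfl⟩ := hne e he
    exact (csInf_le (hbdd e) ⟨F, hF, rfl⟩).trans (hΦB e F hF)
  set D := sSup (d '' Ioi 0) with hD
  have hdD : ∀ e > 0, d e ≤ D := fun e he => le_csSup hdB ⟨e, he, rfl⟩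
  have hmono : ∀ e e', e ≤ e' → ApproxClass f L e ⊆ ApproxClass f L e' :=
    fun e e' h F hF => ⟨hF.1, hF.2.1, fun x => (hF.2.2 x).trans h⟩
  obtain ⟨_, ⟨e1, he1, rfl⟩, hde1⟩ := exists_lt_of_lt_csSup (s := d '' Ioi 0)
    (Set.Nonempty.image d ⟨1, by simp⟩) (show D - η / 8 < sSup (d '' Ioi 0) by linarith)
  have he1' : (0 : ℝ) < e1 := he1
  set e0 := min e1 ε with he0
  have he0p : 0 < e0 := lt_min he1' hε
  have hde0 : D - η / 8 < d e0 := by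
    refine hde1.trans_le (csInf_le_csInf (hbdd e1) (hne e0 he0p) ?_)
    exact image_mono (hmono _ _ (min_le_left _ _))
  have hpick : ∀ e > 0, ∃ F ∈ ApproxClass f L e, Φ F < D + η / 8 := by
    intro e he
    obtain ⟨_, ⟨F, hF, rfl⟩, h⟩ := exists_lt_of_csInf_lt (hne e he)
      (show sInf (Φ '' ApproxClass f L e) < D + η / 8 from
        (hdD e he).trans_lt (by linarith))
    exact ⟨F, hF, h⟩
  obtain ⟨F, hF, hFΦ⟩ := hpick e0 he0p
  refine ⟨F, hmono _ _ (min_le_right _ _) hF, fun ε' hε' => ?_⟩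
  obtain ⟨G, hG, hGΦ⟩ := hpick (min ε' e0) (lt_min hε' he0p)
  refine ⟨G, hmono _ _ (min_le_left _ _) hG, ?_⟩
  have hG0 := hmono _ _ (min_le_right _ _) hG
  let H : EuclideanSpace ℝ (Fin N) → ℝ := fun x => (1 / 2 : ℝ) * (G x + F x)
  have hHd : ∀ x, fderiv ℝ H x = (1 / 2 : ℝ) • (fderiv ℝ G x + fderiv ℝ F x) := by
    intro x
    have hg := (hG.1.differentiable (by norm_num) x).hasFDerivAt
    have hf' := (hF.1.differentiable (by norm_num) x).hasFDerivAt
    exact ((hg.add hf').const_mul (1 / 2 : ℝ)).fderiv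
  have hH : H ∈ ApproxClass f L e0 := by
    refine ⟨contDiff_const.mul (hG.1.add hF.1), ?_, fun x => ?_⟩
    · apply LipschitzWith.of_dist_le_mul
      intro x y
      have h1 := hG.2.1.dist_le_mul x y
      have h2 := hF.2.1.dist_le_mul x y
      rw [Real.dist_eq] at h1 h2 ⊢
      rw [abs_le] at h1 h2 ⊢
      simp only [H]
      constructor <;> linarith
    · have h1 := hG0.2.2 x
      have h2 := hF.2.2 x
      rw [abs_le] at h1 h2 ⊢
      simp only [H]
      constructor <;> linarith
  have hHΦ : D - η / 8 < Φ H := hde0.trans_le (csInf_le (hbdd e0) ⟨H, hH, rfl⟩)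
  have hiG := integrable_fderiv_sq ν hG.1 hG.2.1
  have hiF := integrable_fderiv_sq ν hF.1 hF.2.1
  have hiH := integrable_fderiv_sq ν hH.1 hH.2.1
  have : ∫ x, ‖fderiv ℝ G x - fderiv ℝ F x‖ ^ 2 ∂ν = 2 * Φ G + 2 * Φ F - 4 * Φ H := by
    simp only [Φ]
    rw [← integral_const_mul, ← integral_const_mul, ← integral_const_mul, ← integral_add,
      ← integral_sub]
    · congr 1; ext x
      rw [dual_parallelogram, hHd]
    · exact (hiG.const_mul 2).add (hiF.const_mul 2)
    · exact hiH.const_mul 4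
    · exact hiG.const_mul 2
    · exact hiF.const_mul 2
  rw [this]
  linarith

lemma step_lemma {N : ℕ} (ν : Measure (EuclideanSpace ℝ (Fin N))) [IsFiniteMeasure ν]
    {f : EuclideanSpace ℝ (Fin N) → ℝ} {L : NNReal} (hf : LipschitzWith L f)
    {S E' : Set (EuclideanSpace ℝ (Fin N))} {c : ℝ} (hc : 0 < c)
    (hE : ∀ W, IsOpen W → E' ⊆ W → ν Wᶜ = 0)
    (hbad : ∀ x ∈ E', ∀ F : EuclideanSpace ℝ (Fin N) → ℝ, ContDiff ℝ 1 F → LipschitzWith L F →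
      ∃ᶠ y in 𝓝[S \ {x}] x, c * dist y x < |(f y - F y) - (f x - F x)|)
    {K V : Set (EuclideanSpace ℝ (Fin N))} (hK : IsCompact K) (hV : IsOpen V) (hKV : K ⊆ V)
    {δ η : ℝ} (hδ : 0 < δ) (hη : 0 < η) :
    ∃ (v : EuclideanSpace ℝ (Fin N) → ℝ) (O : Set (EuclideanSpace ℝ (Fin N))) (r' : ℝ),
      0 < r' ∧ IsOpen O ∧ Differentiable ℝ v ∧ (∀ z, |v z| ≤ δ) ∧
      (∀ z, ‖fderiv ℝ v z‖ ≤ 2 * L + 1) ∧ (∀ z, z ∉ V → fderiv ℝ v z = 0) ∧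
      (∀ z ∈ O, ‖fderiv ℝ v z‖ ≤ η) ∧
      (∀ x ∈ K ∩ O, ∃ y ∈ S, r' < dist y x ∧ dist y x < δ ∧ segment ℝ x y ⊆ V ∧
        c / 2 * dist y x < |v y - v x|) ∧
      ν Oᶜ ≤ ENNReal.ofReal η := by
  obtain ⟨r0, hr0, hr0V⟩ := hK.exists_cthickening_subset_open hV hKV
  obtain ⟨χ, M, hχc, hχ1, hχM, hχK, hχV⟩ := cutoff_exists (hK.cthickening (r := r0)) hV hr0V
  have hM0 : 0 ≤ M := (norm_nonneg _).trans (hχM 0)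
  set r := min r0 δ with hr
  have hrp : 0 < r := lt_min hr0 hδ
  -- size of the perturbation
  obtain ⟨ε, hε, hεδ, hε1, hεη⟩ : ∃ ε : ℝ, 0 < ε ∧ 2 * ε ≤ δ ∧ 2 * ε * M ≤ 1 ∧
      2 * ε * M ≤ η / 2 := by
    have h1 : ∀ a : ℝ, 0 < a → a / (2 * (M + 1)) * 2 * M ≤ a := by
      intro a ha
      rw [div_mul_eq_mul_div, div_mul_eq_mul_div, div_le_iff₀ (by positivity)]
      nlinarith
    refine ⟨min (δ / 2) (min (1 / (2 * (M + 1))) ((η / 2) / (2 * (M + 1)))), ?_, ?_, ?_, ?_⟩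
    · positivity
    · have := min_le_left (δ / 2) (min (1 / (2 * (M + 1))) ((η / 2) / (2 * (M + 1))))
      linarith
    · refine le_trans ?_ (h1 1 one_pos)
      have := (min_le_right (δ / 2) (min (1 / (2 * (M + 1))) ((η / 2) / (2 * (M + 1))))).trans
        (min_le_left _ _)
      rw [mul_comm (2 : ℝ)]
      gcongr
    · refine le_trans ?_ (h1 (η / 2) (by positivity))
      have := (min_le_right (δ / 2) (min (1 / (2 * (M + 1))) ((η / 2) / (2 * (M + 1))))).trans
        (min_le_right _ _)
      rw [mul_comm (2 : ℝ)]
      gcongr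
  obtain ⟨F, hF, hFF⟩ := energy_lemma ν hf (η := (η / 2) ^ 2 * (η / 2)) (by positivity) hε
  let W : ℕ → Set (EuclideanSpace ℝ (Fin N)) := fun m =>
    {x | ∃ y ∈ S, 1 / ((m : ℝ) + 1) < dist y x ∧ dist y x < r ∧
      c * dist y x < |(f y - F y) - (f x - F x)|}
  have hWo : ∀ m, IsOpen (W m) := by
    intro m
    have : W m = ⋃ y ∈ S, {x | 1 / ((m : ℝ) + 1) < dist y x ∧ dist y x < r ∧
      c * dist y x < |(f y - F y) - (f x - F x)|} := by
      ext x; simp only [W, mem_iUnion, mem_ofPred_eq, exists_prop]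
    rw [this]
    have hfc := hf.continuous
    have hFc := hF.1.continuous
    refine isOpen_biUnion fun y _ => ?_
    have o1 : IsOpen {x | 1 / ((m : ℝ) + 1) < dist y x} := isOpen_lt (by fun_prop) (by fun_prop)
    have o2 : IsOpen {x | dist y x < r} := isOpen_lt (by fun_prop) (by fun_prop)
    have o3 : IsOpen {x | c * dist y x < |(f y - F y) - (f x - F x)|} :=
      isOpen_lt (by fun_prop) (by fun_prop)
    exact o1.inter (o2.inter o3)
  have hWm : Monotone W := by
    intro m m' h x
    rintro ⟨y, hy, h1, h2⟩
    refine ⟨y, hy, lt_of_le_of_lt ?_ h1, h2⟩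
    have : (m : ℝ) ≤ m' := by exact_mod_cast h
    gcongr
  have hWE : E' ⊆ ⋃ m, W m := by
    intro x hx
    have h1 := hbad x hx F hF.1 hF.2.1
    have h2 : ∀ᶠ y in 𝓝[S \ {x}] x, y ∈ S ∧ y ≠ x ∧ dist y x < r := by
      have ha : ∀ᶠ y in 𝓝[S \ {x}] x, y ∈ S \ {x} := self_mem_nhdsWithin
      have hb : ∀ᶠ y in 𝓝[S \ {x}] x, y ∈ ball x r :=
        mem_nhdsWithin_of_mem_nhds (ball_mem_nhds x hrp)
      filter_upwards [ha, hb] with y hy hy'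
      exact ⟨hy.1, hy.2, hy'⟩
    obtain ⟨y, h3, hyS, hyx, hyr⟩ := (h1.and_eventually h2).exists
    obtain ⟨m, hm⟩ := exists_nat_one_div_lt (dist_pos.2 hyx)
    exact mem_iUnion.2 ⟨m, y, hyS, hm, hyr, h3⟩
  have hW0 : ν (⋃ m, W m)ᶜ = 0 := hE _ (isOpen_iUnion hWo) hWE
  obtain ⟨m, hm⟩ : ∃ m, ν (W m)ᶜ ≤ ENNReal.ofReal (η / 2) := by
    have hanti : Antitone fun m => (W m)ᶜ := fun m m' h => compl_subset_compl.2 (hWm h)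
    have ht := tendsto_measure_iInter_atTop (μ := ν) (s := fun m => (W m)ᶜ)
      (fun m => (hWo m).measurableSet.compl.nullMeasurableSet) hanti ⟨0, measure_ne_top _ _⟩
    rw [← compl_iUnion, hW0] at ht
    have := ht.eventually (ge_mem_nhds (ENNReal.ofReal_pos.2 (show 0 < η / 2 by positivity)))
    exact this.exists
  set r' : ℝ := 1 / ((m : ℝ) + 1) with hr'
  have hr'p : 0 < r' := by positivity
  obtain ⟨F', hF', hintg⟩ := hFF (min ε (c * r' / 8)) (by positivity)
  have hF'1 : ∀ x, |F' x - f x| ≤ ε := fun x => (hF'.2.2 x).trans (min_le_left _ _)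
  have hF'2 : ∀ x, |F' x - f x| ≤ c * r' / 8 := fun x => (hF'.2.2 x).trans (min_le_right _ _)
  have hdF : Differentiable ℝ F := hF.1.differentiable (by norm_num)
  have hdF' : Differentiable ℝ F' := hF'.1.differentiable (by norm_num)
  have hdχ : Differentiable ℝ χ := hχc.differentiable (by norm_num)
  have hcF := hF.1.continuous_fderiv (by norm_num)
  have hcF' := hF'.1.continuous_fderiv (by norm_num)
  let u : EuclideanSpace ℝ (Fin N) → ℝ := fun x => F' x - F x
  have hdu : ∀ z, HasFDerivAt u (fderiv ℝ F' z - fderiv ℝ F z) z := fun z =>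
    (hdF' z).hasFDerivAt.sub (hdF z).hasFDerivAt
  have hu : ∀ z, |u z| ≤ 2 * ε := by
    intro z
    have h1 := abs_le.1 (hF'1 z)
    have h2 := abs_le.1 (hF.2.2 z)
    rw [abs_le]
    simp only [u]
    constructor <;> linarith
  let v : EuclideanSpace ℝ (Fin N) → ℝ := fun x => χ x * u x
  have hdv : ∀ z, HasFDerivAt v (χ z • (fderiv ℝ F' z - fderiv ℝ F z) + u z • fderiv ℝ χ z) z :=
    fun z => (hdχ z).hasFDerivAt.mul (hdu z)
  have hvn : ∀ z, ‖fderiv ℝ v z‖ ≤ ‖fderiv ℝ F' z - fderiv ℝ F z‖ + 2 * ε * M := by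
    intro z
    rw [(hdv z).fderiv]
    refine (norm_add_le _ _).trans (add_le_add ?_ ?_)
    · rw [norm_smul, Real.norm_eq_abs]
      exact mul_le_of_le_one_left (norm_nonneg _) (hχ1 z)
    · rw [norm_smul, Real.norm_eq_abs]
      exact mul_le_mul (hu z) (hχM z) (norm_nonneg _) (by positivity)
  let O := W m ∩ {x | ‖fderiv ℝ F' x - fderiv ℝ F x‖ < η / 2}
  refine ⟨v, O, r', hr'p, ?_, fun z => (hdv z).differentiableAt, ?_, ?_, ?_, ?_, ?_, ?_⟩
  · exact (hWo m).inter (isOpen_lt (by fun_prop) (by fun_prop))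
  · intro z
    simp only [v, abs_mul]
    exact (mul_le_of_le_one_left (abs_nonneg _) (hχ1 z)).trans ((hu z).trans hεδ)
  · intro z
    refine (hvn z).trans ?_
    have h1 := norm_fderiv_le_of_lipschitz ℝ hF.2.1 (x₀ := z)
    have h2 := norm_fderiv_le_of_lipschitz ℝ hF'.2.1 (x₀ := z)
    have h3 := norm_sub_le (fderiv ℝ F' z) (fderiv ℝ F z)
    linarith
  · intro z hz
    have : v =ᶠ[𝓝 z] fun _ => (0 : ℝ) := by
      filter_upwards [hχV z hz] with w hw
      simp [v, hw]
    rw [this.fderiv_eq]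
    simp
  · intro z hz
    have h1 : ‖fderiv ℝ F' z - fderiv ℝ F z‖ < η / 2 := hz.2
    linarith [hvn z]
  · rintro x ⟨hxK, ⟨y, hyS, hy1, hy2, hy3⟩, hx2⟩
    have hsub : closedBall x r0 ⊆ cthickening r0 K := closedBall_subset_cthickening hxK r0
    have hyr0 : dist y x ≤ r0 := hy2.le.trans (min_le_left _ _)
    refine ⟨y, hyS, hy1, hy2.trans_le (min_le_right _ _), ?_, ?_⟩
    · refine ((convex_closedBall x r0).segment_subset (mem_closedBall_self hr0.le) hyr0).trans
        (hsub.trans hr0V)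
    · have hχx : χ x = 1 := hχK x (hsub (mem_closedBall_self hr0.le))
      have hχy : χ y = 1 := hχK y (hsub hyr0)
      simp only [v, u, hχx, hχy, one_mul]
      have h1 := abs_le.1 (hF'2 x)
      have h2 := abs_le.1 (hF'2 y)
      have h4 : c * r' < c * dist y x := by gcongr
      have h5 : |(f y - F y) - (f x - F x)| ≤ |(F' y - F y) - (F' x - F x)| + c * r' / 4 := by
        have : (f y - F y) - (f x - F x) = ((F' y - F y) - (F' x - F x)) +
          ((F' x - f x) - (F' y - f y)) := by ring
        rw [this]
        refine (abs_add_le _ _).trans (add_le_add le_rfl ?_)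
        rw [abs_le]; constructor <;> linarith
      linarith
  · have hmark : ν {x | ‖fderiv ℝ F' x - fderiv ℝ F x‖ < η / 2}ᶜ ≤ ENNReal.ofReal (η / 2) := by
      have hi : Integrable (fun x => ‖fderiv ℝ F' x - fderiv ℝ F x‖ ^ 2) ν := by
        refine Integrable.of_bound ?_ (C := (2 * L : ℝ) ^ 2) ?_
        · exact (((hcF'.sub hcF).norm).pow 2).aestronglyMeasurable
        · refine Eventually.of_forall fun z => ?_
          rw [norm_pow, norm_norm]
          have h1 := norm_fderiv_le_of_lipschitz ℝ hF.2.1 (x₀ := z)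
          have h2 := norm_fderiv_le_of_lipschitz ℝ hF'.2.1 (x₀ := z)
          have h3 := norm_sub_le (fderiv ℝ F' z) (fderiv ℝ F z)
          gcongr
          linarith
      have hmk := mul_meas_ge_le_integral_of_nonneg (μ := ν)
        (f := fun x => ‖fderiv ℝ F' x - fderiv ℝ F x‖ ^ 2)
        (Eventually.of_forall fun x => by positivity) hi ((η / 2) ^ 2)
      have hset : {x | ‖fderiv ℝ F' x - fderiv ℝ F x‖ < η / 2}ᶜ ⊆
          {x | (η / 2) ^ 2 ≤ ‖fderiv ℝ F' x - fderiv ℝ F x‖ ^ 2} := by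
        intro x hx
        simp only [mem_compl_iff, mem_ofPred_eq, not_lt] at hx ⊢
        gcongr
      refine (measure_mono hset).trans ?_
      rw [← ofReal_measureReal]
      apply ENNReal.ofReal_le_ofReal
      have hp : 0 < (η / 2) ^ 2 := by positivity
      exact le_of_mul_le_mul_left (hmk.trans hintg) hp
    rw [show Oᶜ = (W m)ᶜ ∪ {x | ‖fderiv ℝ F' x - fderiv ℝ F x‖ < η / 2}ᶜ from compl_inter _ _]
    refine (measure_union_le _ _).trans ((add_le_add hm hmark).trans ?_)
    rw [← ENNReal.ofReal_add (by positivity) (by positivity), add_halves]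

lemma geom_half_sum_le (θ : ℝ) (hθ : 0 ≤ θ) (m : ℕ) :
    ∑ j ∈ Finset.range m, θ * (1 / 2 : ℝ) ^ j ≤ 2 * θ := by
  rw [← Finset.mul_sum]
  have h := Summable.sum_le_tsum (Finset.range m) (fun j _ => by positivity)
    (summable_geometric_two)
  rw [tsum_geometric_two] at h
  nlinarith

lemma glue_summable {X : Type*} {v : ℕ → X → ℝ} {δ : ℕ → ℝ}
    (hδ : ∀ k, δ (k + 1) ≤ δ k / 2) (hv : ∀ j z, |v j z| ≤ δ j)
    {σ : ℕ → ℝ} {B : ℝ} (hσ : ∀ j, |σ j| ≤ B) (z : X) :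
    Summable fun j => σ j * v j z := by
  have hd : ∀ j, δ j ≤ δ 0 * (1 / 2 : ℝ) ^ j := by
    intro j
    induction j with
    | zero => simp
    | succ k ih => rw [pow_succ]; linarith [hδ k]
  have hB : 0 ≤ B := (abs_nonneg _).trans (hσ 0)
  refine Summable.of_norm_bounded (g := fun j => B * (δ 0 * (1 / 2 : ℝ) ^ j)) ?_ fun j => ?_
  · exact (summable_geometric_two.mul_left _).mul_left _
  · rw [Real.norm_eq_abs, abs_mul]
    exact mul_le_mul (hσ j) ((hv j z).trans (hd j)) (abs_nonneg _) hB

lemma glue_lipschitz {N : ℕ} {v : ℕ → EuclideanSpace ℝ (Fin N) → ℝ} {δ : ℕ → ℝ}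
    {V O : ℕ → Set (EuclideanSpace ℝ (Fin N))} {θ C : ℝ} (hθ : 0 < θ) (hC : 0 ≤ C)
    (hδ : ∀ k, δ (k + 1) ≤ δ k / 2) (hv : ∀ j z, |v j z| ≤ δ j)
    (hvd : ∀ j, Differentiable ℝ (v j)) (hvC : ∀ j z, ‖fderiv ℝ (v j) z‖ ≤ C)
    (hv0 : ∀ j z, z ∉ V j → fderiv ℝ (v j) z = 0)
    (hvO : ∀ j, ∀ z ∈ O j, ‖fderiv ℝ (v j) z‖ ≤ θ * (1 / 2 : ℝ) ^ j)
    (hVO : ∀ k j, k < j → V j ⊆ O k)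
    {σ : ℕ → ℝ} (hσ : ∀ j, |σ j| ≤ 1) :
    LipschitzWith (Real.toNNReal (2 * θ + C)) (fun y => ∑' j, σ j * v j y) := by
  have hsum := glue_summable hδ hv hσ
  have key : ∀ z m, ∑ j ∈ Finset.range m, ‖fderiv ℝ (v j) z‖ ≤ 2 * θ + C := by
    intro z m
    classical
    have : ∃ k, ∀ j, ‖fderiv ℝ (v j) z‖ ≤ θ * (1 / 2 : ℝ) ^ j + if j = k then C else 0 := by
      by_cases h : ∃ k, z ∉ O k
      · refine ⟨Nat.find h, fun j => ?_⟩
        rcases lt_trichotomy j (Nat.find h) with hj | hj | hj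
        · have := not_not.1 (Nat.find_min h hj)
          rw [if_neg hj.ne, add_zero]
          exact hvO j z this
        · rw [if_pos hj]
          have := hvC j z
          have : 0 ≤ θ * (1 / 2 : ℝ) ^ j := by positivity
          linarith [hvC j z]
        · have hz : z ∉ V j := fun hz => Nat.find_spec h (hVO _ _ hj hz)
          rw [hv0 j z hz, norm_zero, if_neg hj.ne']
          positivity
      · push Not at h
        refine ⟨0, fun j => (hvO j z (h j)).trans ?_⟩
        split_ifs <;> linarith
    obtain ⟨k, hk⟩ := this
    refine (Finset.sum_le_sum fun j _ => hk j).trans ?_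
    rw [Finset.sum_add_distrib]
    refine add_le_add (geom_half_sum_le θ hθ.le m) ?_
    rw [Finset.sum_ite_eq']
    split_ifs <;> linarith
  have hpart : ∀ m, LipschitzWith (Real.toNNReal (2 * θ + C))
      (fun y => ∑ j ∈ Finset.range m, σ j * v j y) := by
    intro m
    have hd : ∀ z, HasFDerivAt (fun y => ∑ j ∈ Finset.range m, σ j * v j y)
        (∑ j ∈ Finset.range m, σ j • fderiv ℝ (v j) z) z := fun z =>
      HasFDerivAt.fun_sum fun j _ => ((hvd j z).hasFDerivAt).const_mul (σ j)
    apply lipschitzWith_of_nnnorm_fderiv_le (𝕜 := ℝ) (fun z => (hd z).differentiableAt)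
    intro z
    rw [← NNReal.coe_le_coe, coe_nnnorm, Real.coe_toNNReal _ (by positivity), (hd z).fderiv]
    refine (norm_sum_le _ _).trans (le_trans (Finset.sum_le_sum fun j _ => ?_) (key z m))
    rw [norm_smul, Real.norm_eq_abs]
    exact mul_le_of_le_one_left (norm_nonneg _) (hσ j)
  apply LipschitzWith.of_dist_le_mul
  intro x y
  have hx := (hsum x).hasSum.tendsto_sum_nat
  have hy := (hsum y).hasSum.tendsto_sum_nat
  exact le_of_tendsto (hx.dist hy) (Eventually.of_forall fun m => (hpart m).dist_le_mul x y)

lemma glue_scale {N : ℕ} {v : ℕ → EuclideanSpace ℝ (Fin N) → ℝ} {δ r' : ℕ → ℝ}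
    {V O : ℕ → Set (EuclideanSpace ℝ (Fin N))} {θ : ℝ} (hθ : 0 < θ)
    (hδ : ∀ k, δ (k + 1) ≤ δ k / 2) (hδr : ∀ k, δ (k + 1) ≤ θ * r' k)
    (hv : ∀ j z, |v j z| ≤ δ j)
    (hvd : ∀ j, Differentiable ℝ (v j))
    (hvO : ∀ j, ∀ z ∈ O j, ‖fderiv ℝ (v j) z‖ ≤ θ * (1 / 2 : ℝ) ^ j)
    (hVO : ∀ k j, k < j → V j ⊆ O k)
    {σ : ℕ → ℝ} {B : ℝ} (hσ : ∀ j, |σ j| ≤ B) (k : ℕ) {x y : EuclideanSpace ℝ (Fin N)}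
    (hxy : r' k < dist y x) (hseg : segment ℝ x y ⊆ V k) :
    |(∑' j, σ j * v j y) - (∑' j, σ j * v j x) - σ k * (v k y - v k x)|
      ≤ B * (6 * θ) * dist y x := by
  have hB : 0 ≤ B := (abs_nonneg _).trans (hσ 0)
  have hd : ∀ i, δ (k + 1 + i) ≤ δ (k + 1) * (1 / 2 : ℝ) ^ i := by
    intro i
    induction i with
    | zero => simp
    | succ j ih => rw [pow_succ, ← add_assoc]; linarith [hδ (k + 1 + j)]
  have hsum := glue_summable hδ hv hσ
  have hS : Summable fun j => σ j * (v j y - v j x) := by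
    simpa [mul_sub] using (hsum y).sub (hsum x)
  rw [← (hsum y).tsum_sub (hsum x)]
  simp only [← mul_sub]
  rw [← hS.sum_add_tsum_nat_add (k + 1), Finset.sum_range_succ]
  have h1 : |∑ j ∈ Finset.range k, σ j * (v j y - v j x)| ≤ B * (2 * θ) * dist y x := by
    have : ∀ j ∈ Finset.range k, |σ j * (v j y - v j x)| ≤
        (B * dist y x) * (θ * (1 / 2 : ℝ) ^ j) := by
      intro j hj
      have hj' := Finset.mem_range.1 hj
      have hm := (convex_segment x y).norm_image_sub_le_of_norm_fderiv_le (𝕜 := ℝ)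
        (f := v j) (C := θ * (1 / 2 : ℝ) ^ j) (fun z _ => hvd j z)
        (fun z hz => hvO j z (hVO j k hj' (hseg hz)))
        (left_mem_segment ℝ x y) (right_mem_segment ℝ x y)
      rw [Real.norm_eq_abs, ← dist_eq_norm] at hm
      rw [abs_mul]
      calc |σ j| * |v j y - v j x| ≤ B * (θ * (1 / 2 : ℝ) ^ j * dist y x) :=
            mul_le_mul (hσ j) hm (abs_nonneg _) hB
        _ = _ := by ring
    refine (Finset.abs_sum_le_sum_abs _ _).trans ((Finset.sum_le_sum this).trans ?_)
    rw [← Finset.mul_sum]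
    calc _ ≤ (B * dist y x) * (2 * θ) :=
          mul_le_mul_of_nonneg_left (geom_half_sum_le θ hθ.le k) (by positivity)
      _ = _ := by ring
  have h2 : |∑' i, σ (i + (k + 1)) * (v (i + (k + 1)) y - v (i + (k + 1)) x)| ≤
      B * (4 * θ) * dist y x := by
    have hg : HasSum (fun i : ℕ => (B * (2 * θ) * dist y x) * (1 / 2 : ℝ) ^ i)
        ((B * (2 * θ) * dist y x) * 2) := hasSum_geometric_two.mul_left _
    have := tsum_of_norm_bounded hg
      (f := fun i => σ (i + (k + 1)) * (v (i + (k + 1)) y - v (i + (k + 1)) x)) (fun i => ?_)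
    · rw [Real.norm_eq_abs] at this
      linarith
    · rw [Real.norm_eq_abs, abs_mul]
      have h3 : |v (i + (k + 1)) y - v (i + (k + 1)) x| ≤ 2 * θ * dist y x * (1 / 2 : ℝ) ^ i := by
        have a1 := abs_le.1 (hv (i + (k + 1)) y)
        have a2 := abs_le.1 (hv (i + (k + 1)) x)
        have a3 := hd i
        rw [add_comm] at a3
        have a4 : δ (k + 1) * (1 / 2 : ℝ) ^ i ≤ θ * dist y x * (1 / 2 : ℝ) ^ i := by
          have := hδr k
          gcongr
          exact this.trans (by gcongr)
        rw [abs_le]; constructor <;> linarith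
      calc _ ≤ B * (2 * θ * dist y x * (1 / 2 : ℝ) ^ i) :=
            mul_le_mul (hσ _) h3 (abs_nonneg _) hB
        _ = _ := by ring
  rw [abs_le] at h1 h2 ⊢
  constructor <;> linarith

lemma construct_seq {N : ℕ} (ν : Measure (EuclideanSpace ℝ (Fin N))) [IsFiniteMeasure ν]
    {f : EuclideanSpace ℝ (Fin N) → ℝ} {L : NNReal} (hf : LipschitzWith L f)
    {S E' : Set (EuclideanSpace ℝ (Fin N))} {c : ℝ} (hc : 0 < c)
    (hE : ∀ W, IsOpen W → E' ⊆ W → ν Wᶜ = 0)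
    (hbad : ∀ x ∈ E', ∀ F : EuclideanSpace ℝ (Fin N) → ℝ, ContDiff ℝ 1 F → LipschitzWith L F →
      ∃ᶠ y in 𝓝[S \ {x}] x, c * dist y x < |(f y - F y) - (f x - F x)|)
    {K₀ : Set (EuclideanSpace ℝ (Fin N))} (hK₀ : IsCompact K₀) {θ : ℝ} (hθ : 0 < θ) :
    ∃ (K V O : ℕ → Set (EuclideanSpace ℝ (Fin N))) (δ r' : ℕ → ℝ)
      (v : ℕ → EuclideanSpace ℝ (Fin N) → ℝ),
      K 0 = K₀ ∧ (∀ k, IsCompact (K k)) ∧ (∀ k, 0 < δ k) ∧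
      (∀ k, K (k + 1) ⊆ K k ∩ O k) ∧ (∀ k, V (k + 1) = V k ∩ O k) ∧
      (∀ k, δ (k + 1) ≤ δ k / 2) ∧ (∀ k, δ (k + 1) ≤ θ * r' k) ∧
      (∀ k, ν (K k \ K (k + 1)) ≤ ENNReal.ofReal (2 * (θ * (1 / 2 : ℝ) ^ k))) ∧
      (∀ k, Differentiable ℝ (v k)) ∧ (∀ k z, |v k z| ≤ δ k) ∧
      (∀ k z, ‖fderiv ℝ (v k) z‖ ≤ 2 * L + 1) ∧ (∀ k z, z ∉ V k → fderiv ℝ (v k) z = 0) ∧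
      (∀ k, ∀ z ∈ O k, ‖fderiv ℝ (v k) z‖ ≤ θ * (1 / 2 : ℝ) ^ k) ∧
      (∀ k, ∀ x ∈ K k ∩ O k, ∃ y ∈ S, r' k < dist y x ∧ dist y x < δ k ∧
        segment ℝ x y ⊆ V k ∧ c / 2 * dist y x < |v k y - v k x|) := by
  let St := {p : Set (EuclideanSpace ℝ (Fin N)) × Set (EuclideanSpace ℝ (Fin N)) × ℝ //
    IsCompact p.1 ∧ IsOpen p.2.1 ∧ p.1 ⊆ p.2.1 ∧ 0 < p.2.2}
  have step : ∀ (k : ℕ) (p : St), ∃ (q : St) (v : EuclideanSpace ℝ (Fin N) → ℝ)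
      (O : Set (EuclideanSpace ℝ (Fin N))) (r' : ℝ),
      q.1.1 ⊆ p.1.1 ∩ O ∧ q.1.2.1 = p.1.2.1 ∩ O ∧ q.1.2.2 ≤ p.1.2.2 / 2 ∧ q.1.2.2 ≤ θ * r' ∧
      ν (p.1.1 \ q.1.1) ≤ ENNReal.ofReal (2 * (θ * (1 / 2 : ℝ) ^ k)) ∧
      Differentiable ℝ v ∧ (∀ z, |v z| ≤ p.1.2.2) ∧
      (∀ z, ‖fderiv ℝ v z‖ ≤ 2 * L + 1) ∧ (∀ z, z ∉ p.1.2.1 → fderiv ℝ v z = 0) ∧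
      (∀ z ∈ O, ‖fderiv ℝ v z‖ ≤ θ * (1 / 2 : ℝ) ^ k) ∧
      (∀ x ∈ p.1.1 ∩ O, ∃ y ∈ S, r' < dist y x ∧ dist y x < p.1.2.2 ∧
        segment ℝ x y ⊆ p.1.2.1 ∧ c / 2 * dist y x < |v y - v x|) := by
    rintro k ⟨⟨K, V, δ⟩, hK, hV, hKV, hδ⟩
    simp only at hK hV hKV hδ
    have hη : 0 < θ * (1 / 2 : ℝ) ^ k := by positivity
    obtain ⟨v, O, r', hr', hO, h1, h2, h3, h4, h5, h6, h7⟩ :=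
      step_lemma ν hf hc hE hbad hK hV hKV hδ hη
    have hm : MeasurableSet (K ∩ O) := hK.measurableSet.inter hO.measurableSet
    obtain ⟨K', hK's, hK'c, hK'm⟩ := hm.exists_isCompact_sdiff_lt (μ := ν) (measure_ne_top _ _)
      (ENNReal.ofReal_pos.2 hη).ne'
    refine ⟨⟨⟨K', V ∩ O, min (δ / 2) (θ * r')⟩, hK'c, hV.inter hO, ?_, ?_⟩, v, O, r', hK's, rfl,
      min_le_left _ _, min_le_right _ _, ?_, h1, h2, h3, h4, h5, h6⟩
    · exact hK's.trans (inter_subset_inter_left _ hKV)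
    · simp only; positivity
    · have hsub : K \ K' ⊆ ((K ∩ O) \ K') ∪ Oᶜ := by
        rintro x ⟨hx, hx'⟩
        by_cases hxO : x ∈ O
        · exact Or.inl ⟨⟨hx, hxO⟩, hx'⟩
        · exact Or.inr hxO
      refine (measure_mono hsub).trans ((measure_union_le _ _).trans
        ((add_le_add hK'm.le h7).trans ?_))
      rw [← ENNReal.ofReal_add hη.le hη.le, two_mul]
  choose nx v O r' hs using step
  let p : ℕ → St := fun k => Nat.rec
    (⟨⟨K₀, univ, 1⟩, hK₀, isOpen_univ, subset_univ _, one_pos⟩ : St) (fun k q => nx k q) k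
  have hp : ∀ k, p (k + 1) = nx k (p k) := fun k => rfl
  refine ⟨fun k => (p k).1.1, fun k => (p k).1.2.1, fun k => O k (p k), fun k => (p k).1.2.2,
    fun k => r' k (p k), fun k => v k (p k), rfl, fun k => (p k).2.1, fun k => (p k).2.2.2.2,
    ?_, ?_, ?_, ?_, ?_, ?_, ?_, ?_, ?_, ?_, ?_⟩ <;> intro k <;>
  obtain ⟨a1, a2, a3, a4, a5, a6, a7, a8, a9, a10, a11⟩ := hs k (p k)
  · simpa only [hp] using a1
  · simpa only [hp] using a2
  · simpa only [hp] using a3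
  · simpa only [hp] using a4
  · simpa only [hp] using a5
  · exact a6
  · exact a7
  · exact a8
  · exact a9
  · exact a10
  · exact a11

lemma many_independent {N : ℕ} (ν : Measure (EuclideanSpace ℝ (Fin N))) [IsFiniteMeasure ν]
    {f : EuclideanSpace ℝ (Fin N) → ℝ} {L : NNReal} (hf : LipschitzWith L f)
    {S E' : Set (EuclideanSpace ℝ (Fin N))} {c : ℝ} (hc : 0 < c)
    (hE : ∀ W, IsOpen W → E' ⊆ W → ν Wᶜ = 0)
    (hbad : ∀ x ∈ E', ∀ F : EuclideanSpace ℝ (Fin N) → ℝ, ContDiff ℝ 1 F → LipschitzWith L F →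
      ∃ᶠ y in 𝓝[S \ {x}] x, c * dist y x < |(f y - F y) - (f x - F x)|)
    {K₀ : Set (EuclideanSpace ℝ (Fin N))} (hK₀ : IsCompact K₀) (hK₀ν : ν K₀ ≠ 0) (n : ℕ) :
    ∃ g : Fin (n + 1) → EuclideanSpace ℝ (Fin N) → ℝ, (∀ s, ∃ C, LipschitzWith C (g s)) ∧
      ∃ A : Set (EuclideanSpace ℝ (Fin N)), ν A ≠ 0 ∧ ∀ x ∈ A, ∀ b : Fin (n + 1) → ℝ, b ≠ 0 →
        ¬ Tendsto (fun y => |∑ s, b s * (g s y - g s x)| / dist y x) (𝓝[S \ {x}] x) (𝓝 0) := by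
  have hm0 : 0 < ν.real K₀ := by
    rw [measureReal_def]; exact ENNReal.toReal_pos hK₀ν (measure_ne_top _ _)
  obtain ⟨θ, hθ, hθc, hθm⟩ : ∃ θ : ℝ, 0 < θ ∧ 6 * θ ≤ c / 4 ∧ 4 * θ < ν.real K₀ := by
    refine ⟨min (c / 24) (ν.real K₀ / 8), by positivity, ?_, ?_⟩
    · linarith [min_le_left (c / 24) (ν.real K₀ / 8)]
    · linarith [min_le_right (c / 24) (ν.real K₀ / 8)]
  obtain ⟨K, V, O, δ, r', v, hK0, hKc, hδp, hKK, hVV, hδ2, hδr, hKν, hvd, hvδ, hvC, hv0, hvO,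
    hvs⟩ := construct_seq ν hf hc hE hbad hK₀ hθ
  have hVanti : Antitone V := antitone_nat_of_succ_le fun k => by
    rw [hVV k]; exact inter_subset_left
  have hVO : ∀ k j, k < j → V j ⊆ O k := fun k j h =>
    (hVanti (Nat.succ_le_of_lt h)).trans (by rw [Nat.succ_eq_add_one, hVV k]; exact inter_subset_right)
  let σ : Fin (n + 1) → ℕ → ℝ := fun s j => if j % (n + 1) = s then 1 else 0
  have hσ : ∀ s j, |σ s j| ≤ 1 := by
    intro s j; simp only [σ]; split_ifs <;> simp
  refine ⟨fun s y => ∑' j, σ s j * v j y, fun s => ⟨_, glue_lipschitz hθ (by positivity) hδ2 hvδ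
    hvd hvC hv0 hvO hVO (hσ s)⟩, ⋂ k, K k, ?_, ?_⟩
  · intro h0
    have hcov : K₀ ⊆ (⋂ k, K k) ∪ ⋃ k, (K k \ K (k + 1)) := by
      intro x hx
      by_contra hcon
      simp only [mem_union, mem_iInter, mem_iUnion, not_or, not_exists, Set.mem_sdiff, not_and,
        not_not] at hcon
      refine hcon.1 fun k => ?_
      induction k with
      | zero => rw [hK0]; exact hx
      | succ k ih => exact hcon.2 k ih
    have h1 : ν K₀ ≤ ENNReal.ofReal (4 * θ) := by
      refine (measure_mono hcov).trans ((measure_union_le _ _).trans ?_)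
      rw [h0, zero_add]
      refine (measure_iUnion_le _).trans ((ENNReal.tsum_le_tsum hKν).trans ?_)
      have hs : HasSum (fun k : ℕ => 2 * (θ * (1 / 2 : ℝ) ^ k)) (2 * (θ * 2)) :=
        (hasSum_geometric_two.mul_left θ).mul_left 2
      rw [← ENNReal.ofReal_tsum_of_nonneg (fun k => by positivity) hs.summable, hs.tsum_eq]
      apply ENNReal.ofReal_le_ofReal; linarith
    have h2 : ν.real K₀ ≤ 4 * θ := by
      rw [measureReal_def]; exact ENNReal.toReal_le_of_le_ofReal (by positivity) h1
    linarith
  · intro x hx b hb ht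
    rw [mem_iInter] at hx
    obtain ⟨s, hs⟩ := exists_max_image univ (fun s => |b s|) finite_univ ⟨0, mem_univ _⟩
    have hsmax : ∀ t, |b t| ≤ |b s| := fun t => hs.2 t (mem_univ _)
    have hbs : 0 < |b s| := by
      obtain ⟨t, ht⟩ := Function.ne_iff.1 hb
      exact (abs_pos.2 ht).trans_le (hsmax t)
    let τ : ℕ → ℝ := fun j => b (Fin.ofNat (n + 1) j)
    have hτ : ∀ j, |τ j| ≤ |b s| := fun j => hsmax _
    have hcomb : ∀ y, ∑ t, b t * (∑' j, σ t j * v j y) = ∑' j, τ j * v j y := by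
      intro y
      simp only [← tsum_mul_left]
      rw [← Summable.tsum_finsetSum
        (fun t _ => (glue_summable hδ2 hvδ (hσ t) y).mul_left (b t))]
      congr 1; ext j
      rw [Finset.sum_eq_single (Fin.ofNat (n + 1) j)]
      · simp [σ, τ]
      · intro t _ hne
        have : ¬ (j % (n + 1) = t) := fun h => hne (by ext; simp [h])
        simp [σ, this]
      · simp
    -- the scales
    have hy : ∀ k, ∃ y ∈ S, r' k < dist y x ∧ dist y x < δ k ∧ segment ℝ x y ⊆ V k ∧
        c / 2 * dist y x < |v k y - v k x| := fun k => hvs k x (hKK k (hx (k + 1)))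
    choose y hyS hyr hyδ hyV hyv using hy
    have hδd : ∀ j, δ j ≤ δ 0 * (1 / 2 : ℝ) ^ j := by
      intro j
      induction j with
      | zero => simp
      | succ k ih => rw [pow_succ]; linarith [hδ2 k]
    have hrpos : ∀ k, 0 < r' k := fun k =>
      pos_of_mul_pos_right ((hδp (k + 1)).trans_le (hδr k)) hθ.le
    have hytend : Tendsto y atTop (𝓝[S \ {x}] x) := by
      rw [tendsto_nhdsWithin_iff]
      constructor
      · rw [tendsto_iff_dist_tendsto_zero]
        refine squeeze_zero (fun _ => dist_nonneg) (fun k => (hyδ k).le.trans (hδd k)) ?_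
        simpa using (tendsto_pow_atTop_nhds_zero_of_lt_one (r := (1 / 2 : ℝ)) (by norm_num)
          (by norm_num)).const_mul (δ 0)
      · refine Eventually.of_forall fun k => ⟨hyS k, ?_⟩
        intro h
        have h' : y k = x := h
        have := (hrpos k).trans (hyr k)
        rw [h', dist_self] at this
        exact lt_irrefl _ this
    have hsub : Tendsto (fun i : ℕ => i * (n + 1) + (s : ℕ)) atTop atTop := by
      apply tendsto_atTop_mono (f := fun i : ℕ => i) _ tendsto_id
      intro i
      nlinarith [Nat.zero_le (i * n), Nat.zero_le (s : ℕ)]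
    have hlim := (ht.comp hytend).comp hsub
    have hpos : 0 < |b s| * (c / 4) := by positivity
    obtain ⟨i, hi⟩ := (hlim.eventually (gt_mem_nhds hpos)).exists
    simp only [Function.comp] at hi
    set k := i * (n + 1) + (s : ℕ) with hk
    have hτk : τ k = b s := by
      simp only [τ]
      congr 1
      ext
      simp only [Fin.ofNat, hk]
      rw [Nat.mul_add_mod', Nat.mod_eq_of_lt s.2]
    have hdpos : 0 < dist (y k) x := (hrpos k).trans (hyr k)
    rw [div_lt_iff₀ hdpos] at hi
    have hrew : ∑ t, b t * ((∑' j, σ t j * v j (y k)) - ∑' j, σ t j * v j x) =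
        (∑' j, τ j * v j (y k)) - ∑' j, τ j * v j x := by
      rw [← hcomb, ← hcomb, ← Finset.sum_sub_distrib]
      simp only [mul_sub]
    rw [hrew] at hi
    have hsc := glue_scale hθ hδ2 hδr hvδ hvd hvO hVO hτ k (hyr k) (hyV k)
    rw [hτk] at hsc
    have h1 : |b s * (v k (y k) - v k x)| ≤
        |(∑' j, τ j * v j (y k)) - ∑' j, τ j * v j x| + |b s| * (6 * θ) * dist (y k) x := by
      have := abs_sub_abs_le_abs_sub (b s * (v k (y k) - v k x))
        ((∑' j, τ j * v j (y k)) - ∑' j, τ j * v j x)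
      rw [abs_sub_comm (b s * (v k (y k) - v k x))] at this
      linarith
    rw [abs_mul] at h1
    have h2 : |b s| * (c / 2 * dist (y k) x) < |b s| * |v k (y k) - v k x| :=
      mul_lt_mul_of_pos_left (hyv k) hbs
    have h3 : |b s| * (6 * θ) * dist (y k) x ≤ |b s| * (c / 4) * dist (y k) x := by gcongr
    linarith

lemma bad_point {N : ℕ} {f : EuclideanSpace ℝ (Fin N) → ℝ} {L : NNReal}
    {S : Set (EuclideanSpace ℝ (Fin N))} {x : EuclideanSpace ℝ (Fin N)}
    (h : ¬ ∃ p, HasChartDerivAt S (id : EuclideanSpace ℝ (Fin N) → _) f x p) :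
    ∃ m : ℕ, ∀ F : EuclideanSpace ℝ (Fin N) → ℝ, ContDiff ℝ 1 F → LipschitzWith L F →
      ∃ᶠ y in 𝓝[S \ {x}] x, 1 / ((m : ℝ) + 1) * dist y x < |(f y - F y) - (f x - F x)| := by
  by_contra hcon
  push Not at hcon
  have key : ∀ m : ℕ, ∃ p : EuclideanSpace ℝ (Fin N), ‖p‖ ≤ L ∧ ∀ᶠ y in 𝓝[S \ {x}] x,
      |f y - f x - ⟪p, y - x⟫| ≤ 2 * (1 / ((m : ℝ) + 1)) * dist y x := by
    intro m
    obtain ⟨F, hF, hFL, hFe⟩ := hcon m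
    have hd : DifferentiableAt ℝ F x := hF.differentiable (by norm_num) x
    refine ⟨gradient F x, ?_, ?_⟩
    · rw [gradient, LinearIsometryEquiv.norm_map]
      exact norm_fderiv_le_of_lipschitz ℝ hFL
    · have h1 := hd.hasFDerivAt.isLittleO.def (c := 1 / ((m : ℝ) + 1)) (by positivity)
      filter_upwards [hFe, nhdsWithin_le_nhds h1] with y hy1 hy2
      rw [inner_gradient_left]
      rw [Real.norm_eq_abs, ← dist_eq_norm] at hy2
      rw [abs_le] at hy1 hy2 ⊢
      constructor <;> linarith
  choose p hpL hp using key
  obtain ⟨q, -, φ, hφ, hq⟩ := (isCompact_closedBall (0 : EuclideanSpace ℝ (Fin N)) L).tendsto_subseq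
    (x := p) (fun m => by simpa using hpL m)
  refine h ⟨q, ?_⟩
  unfold HasChartDerivAt
  rw [Metric.tendsto_nhds]
  intro ε hε
  have e1 : ∀ᶠ i in atTop, dist (p (φ i)) q < ε / 4 := by
    have := (Metric.tendsto_nhds.1 hq) (ε / 4) (by positivity)
    exact this
  have e2 : ∀ᶠ i in atTop, 1 / (((φ i : ℕ) : ℝ) + 1) < ε / 8 :=
    ((tendsto_one_div_add_atTop_nhds_zero_nat (𝕜 := ℝ)).comp hφ.tendsto_atTop).eventually
      (gt_mem_nhds (by positivity))
  obtain ⟨i, hi1, hi2⟩ := (e1.and e2).exists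
  have ha : ∀ᶠ y in 𝓝[S \ {x}] x, y ∈ S \ {x} := self_mem_nhdsWithin
  filter_upwards [hp (φ i), ha] with y hy hyS
  have hdp : 0 < dist y x := dist_pos.2 hyS.2
  rw [Real.dist_eq, sub_zero, abs_div, abs_abs, abs_of_pos hdp, div_lt_iff₀ hdp]
  simp only [id]
  have h3 : |⟪p (φ i) - q, y - x⟫| ≤ ε / 4 * dist y x := by
    refine (abs_real_inner_le_norm _ _).trans ?_
    rw [← dist_eq_norm, ← dist_eq_norm]
    gcongr
  rw [inner_sub_left] at h3
  have h4 : 2 * (1 / (((φ i : ℕ) : ℝ) + 1)) * dist y x ≤ ε / 4 * dist y x := by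
    gcongr; linarith
  have h5 : |f y - f x - ⟪q, y - x⟫| ≤ ε / 2 * dist y x := by
    rw [abs_le] at hy h3 ⊢
    constructor <;> linarith
  have h6 : 0 < ε * dist y x := by positivity
  linarith

lemma exists_deriv_on_chart {N : ℕ} (μ : Measure (EuclideanSpace ℝ (Fin N)))
    [IsFiniteMeasureOnCompacts μ] {S U : Set (EuclideanSpace ℝ (Fin N))} {n : ℕ}
    {φ : EuclideanSpace ℝ (Fin N) → EuclideanSpace ℝ (Fin n)}
    (hdiff : ∀ g : EuclideanSpace ℝ (Fin N) → ℝ, IsLipschitzOn g S →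
      ∀ᵐ x ∂(μ.restrict U), ∃ df, HasChartDerivAt S φ g x df)
    (hU : MeasurableSet U)
    {f : EuclideanSpace ℝ (Fin N) → ℝ} {L : NNReal} (hf : LipschitzWith L f) :
    ∀ᵐ x ∂(μ.restrict U), ∃ p, HasChartDerivAt S (id : EuclideanSpace ℝ (Fin N) → _) f x p := by
  rw [ae_restrict_iff' hU]
  let Em : ℕ → ℕ → Set (EuclideanSpace ℝ (Fin N)) := fun m R =>
    {x | x ∈ U ∧ x ∈ closedBall (0 : EuclideanSpace ℝ (Fin N)) R ∧
      ∀ F : EuclideanSpace ℝ (Fin N) → ℝ, ContDiff ℝ 1 F → LipschitzWith L F →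
      ∃ᶠ y in 𝓝[S \ {x}] x, 1 / ((m : ℝ) + 1) * dist y x < |(f y - F y) - (f x - F x)|}
  suffices hnull : ∀ m R, μ (Em m R) = 0 by
    have : μ (⋃ m, ⋃ R, Em m R) = 0 :=
      measure_iUnion_null fun m => measure_iUnion_null fun R => hnull m R
    rw [ae_iff]
    refine measure_mono_null ?_ this
    intro x hx
    simp only [mem_ofPred_eq, Classical.not_imp] at hx
    obtain ⟨m, hm⟩ := bad_point (L := L) hx.2
    obtain ⟨R, hR⟩ := exists_nat_ge (dist x 0)
    exact mem_iUnion.2 ⟨m, mem_iUnion.2 ⟨R, hx.1, hR, hm⟩⟩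
  intro m R
  by_contra hne
  set E' := Em m R with hE'
  have hE'B : E' ⊆ closedBall (0 : EuclideanSpace ℝ (Fin N)) R := fun x hx => hx.2.1
  have hE'U : E' ⊆ U := fun x hx => hx.1
  have hfin : μ E' < ∞ := (measure_mono hE'B).trans_lt (isCompact_closedBall _ _).measure_lt_top
  let ν := μ.restrict E'
  have : IsFiniteMeasure ν := ⟨by simpa [ν] using hfin⟩
  have hE : ∀ W, IsOpen W → E' ⊆ W → ν Wᶜ = 0 := by
    intro W hW hEW
    rw [Measure.restrict_apply hW.measurableSet.compl]
    rw [(disjoint_compl_left_iff_subset.2 hEW).inter_eq]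
    exact measure_empty
  have hK₀ : ν (closedBall (0 : EuclideanSpace ℝ (Fin N)) R) ≠ 0 := by
    rw [Measure.restrict_apply measurableSet_closedBall, inter_eq_self_of_subset_right hE'B]
    exact hne
  obtain ⟨g, hgL, A, hA, hAx⟩ := many_independent ν hf
    (show (0 : ℝ) < 1 / ((m : ℝ) + 1) by positivity) hE (fun x hx => hx.2.2)
    (isCompact_closedBall (0 : EuclideanSpace ℝ (Fin N)) R) hK₀ n
  have hall : ∀ᵐ x ∂ν, ∀ s, ∃ df, HasChartDerivAt S φ (g s) x df := by
    rw [ae_all_iff]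
    intro s
    obtain ⟨C, hC⟩ := hgL s
    exact ae_restrict_of_ae_restrict_of_subset hE'U (hdiff (g s) ⟨C, hC.lipschitzOnWith⟩)
  obtain ⟨x, hxA, hx⟩ : ∃ x ∈ A, ∀ s, ∃ df, HasChartDerivAt S φ (g s) x df := by
    by_contra hcon
    push Not at hcon
    refine hA (measure_mono_null (fun x hx => ?_) (ae_iff.1 hall))
    obtain ⟨s, hs⟩ := hcon x hx
    simp only [mem_ofPred_eq, not_forall]
    exact ⟨s, fun ⟨df, hdf⟩ => hs df hdf⟩
  choose df hdf using hx
  obtain ⟨b, hb0, hb1⟩ : ∃ b : Fin (n + 1) → ℝ, ∑ s, b s • df s = 0 ∧ b ≠ 0 := by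
    have hnl : ¬ LinearIndependent ℝ df := by
      intro hli
      have := hli.fintype_card_le_finrank
      simp at this
    obtain ⟨b, h1, i, h2⟩ := Fintype.not_linearIndependent_iff.1 hnl
    exact ⟨b, h1, fun h => h2 (by rw [h]; rfl)⟩
  refine hAx x hxA b hb1 ?_
  have hlim : Tendsto (fun y => ∑ s, |b s| * (|g s y - g s x - ⟪df s, φ y - φ x⟫| / dist y x))
      (𝓝[S \ {x}] x) (𝓝 0) := by
    have := tendsto_finsetSum Finset.univ fun s _ => (hdf s).const_mul |b s|
    simpa using this
  refine squeeze_zero (fun y => by positivity) (fun y => ?_) hlim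
  have hsum : ∑ s, b s * (g s y - g s x) =
      ∑ s, b s * (g s y - g s x - ⟪df s, φ y - φ x⟫) := by
    have h0 : ∑ s, b s * ⟪df s, φ y - φ x⟫ = 0 := by
      have : ⟪∑ s, b s • df s, φ y - φ x⟫ = 0 := by rw [hb0, inner_zero_left]
      rw [sum_inner] at this
      simpa only [real_inner_smul_left] using this
    have h1 : ∑ s, b s * (g s y - g s x - ⟪df s, φ y - φ x⟫) =
        ∑ s, b s * (g s y - g s x) - ∑ s, b s * ⟪df s, φ y - φ x⟫ := by
      rw [← Finset.sum_sub_distrib]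
      exact Finset.sum_congr rfl fun s _ => by ring
    rw [h1, h0, sub_zero]
  rw [hsum]
  simp only [← mul_div_assoc]
  rw [← Finset.sum_div]
  apply div_le_div_of_nonneg_right _ dist_nonneg
  refine (Finset.abs_sum_le_sum_abs _ _).trans (le_of_eq ?_)
  exact Finset.sum_congr rfl fun s _ => abs_mul _ _

/-- Let `μ` be a Radon measure on `ℝ^N` such that `(supp μ, |·|, μ)` is a
Lipschitz differentiability space, and assume the nondegeneracy condition: for `μ`-a.e.
`x₀ ∈ supp μ`, the only `ℓ ∈ ℝ^N` with `lim_{x → x₀, x ∈ supp μ} |ℓ ⬝ (x - x₀)|/‖x - x₀‖ = 0`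
is `ℓ = 0`. Then `(supp μ, |·|, μ)` is a Lipschitz differentiability space with respect to the
single `N`-dimensional chart `(supp μ, id)`: every function Lipschitz on `supp μ` has, at
`μ`-a.e. `x₀ ∈ supp μ`, a unique differential `df(x₀) ∈ ℝ^N` w.r.t. the identity chart. -/
theorem stmt3 {N : ℕ} (μ : Measure (EuclideanSpace ℝ (Fin N))) [μ.Regular]
    (hLDS : IsLDS μ (msupport μ))
    (hnd : ∀ᵐ x₀ ∂(μ.restrict (msupport μ)), ∀ ℓ : EuclideanSpace ℝ (Fin N),
      Tendsto (fun x => |⟪ℓ, x - x₀⟫| / ‖x - x₀‖)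
        (𝓝[msupport μ \ {x₀}] x₀) (𝓝 0) → ℓ = 0) :
    ∀ f : EuclideanSpace ℝ (Fin N) → ℝ, IsLipschitzOn f (msupport μ) →
      ∀ᵐ x₀ ∂(μ.restrict (msupport μ)),
        ∃! df : EuclideanSpace ℝ (Fin N),
          HasChartDerivAt (msupport μ) (id : EuclideanSpace ℝ (Fin N) → _) f x₀ df := by
  intro f hfL
  obtain ⟨n, U, φ, hc⟩ := hLDS
  obtain ⟨C, hC⟩ := hfL
  obtain ⟨fe, hfe, hfeq⟩ := hC.extend_real
  set S := msupport μ with hS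
  have hex : ∀ i, ∀ᵐ x ∂(μ.restrict (U i)),
      ∃ p, HasChartDerivAt S (id : EuclideanSpace ℝ (Fin N) → _) f x p := by
    intro i
    have h1 := exists_deriv_on_chart μ (S := S) (φ := φ i)
      (fun g hg => (hc.diff g hg i).mono fun x hx => hx.exists) (hc.borel i) hfe
    filter_upwards [h1, ae_restrict_mem (hc.borel i)] with x hx hxU
    obtain ⟨p, hp⟩ := hx
    refine ⟨p, hp.congr' ?_⟩
    have ha : ∀ᶠ y in 𝓝[S \ {x}] x, y ∈ S \ {x} := self_mem_nhdsWithin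
    filter_upwards [ha] with y hy
    rw [hfeq hy.1, hfeq (hc.subset i hxU)]
  have hex' : ∀ᵐ x ∂(μ.restrict S),
      ∃ p, HasChartDerivAt S (id : EuclideanSpace ℝ (Fin N) → _) f x p := by
    have h1 : ∀ᵐ x ∂(μ.restrict (⋃ i, U i)),
        ∃ p, HasChartDerivAt S (id : EuclideanSpace ℝ (Fin N) → _) f x p :=
      (ae_restrict_iUnion_iff _ _).2 hex
    have h2 : S ≤ᵐ[μ] (⋃ i, U i : Set (EuclideanSpace ℝ (Fin N))) :=
      ae_le_set.2 hc.cover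
    exact ae_mono (Measure.restrict_mono_ae h2) h1
  filter_upwards [hex', hnd] with x hx hnx
  obtain ⟨p, hp⟩ := hx
  refine ⟨p, hp, fun q hq => ?_⟩
  rw [← sub_eq_zero]
  apply hnx
  have hadd : Tendsto _ _ _ := Tendsto.add hp hq
  rw [add_zero] at hadd
  refine squeeze_zero (fun y => by positivity) (fun y => ?_) hadd
  rw [← add_div, dist_eq_norm]
  apply div_le_div_of_nonneg_right _ (norm_nonneg _)
  simp only [id]
  rw [inner_sub_left]
  have : ⟪q, y - x⟫ - ⟪p, y - x⟫ =
      (f y - f x - ⟪p, y - x⟫) - (f y - f x - ⟪q, y - x⟫) := by ring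
  rw [this]
  exact abs_sub _ _
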